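/- arXiv:2601.03577 — 4 statements merged into one kernel-verified Lean document; each statement's English description precedes it below -/
import Mathlib

section
/- Let E ≥ 1, let p be a probability vector on Fin E with p_i > 0 for all i, and let 1 ≤ k ≤ E. Let S ⊆ Fin E be a top-k set for p, i.e. |S| = k and p_i ≥ p_j for every i ∈ S and every j ∉ S. Define q* by q*_i = p_i / (∑_{j∈S} p_j) for i ∈ S and q*_i = 0 otherwise. Then q* is a probability vector with at most k nonzero entries, and for every probability vector q on Fin E with at most k nonzero entries, D_KL(q* ‖ p) ≤ D_KL(q ‖ p). -/
open Finset

/-- A finset whose values dominate those of a nonnegative `p` outside it has the largest sum among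
all finsets with at most as many elements. -/
lemma sum_le_sum_of_card_le_of_dominates {ι : Type*} [DecidableEq ι] {p : ι → ℝ}
    (hp : ∀ i, 0 ≤ p i) {S T : Finset ι} (hcard : T.card ≤ S.card)
    (hdom : ∀ i ∈ S, ∀ j ∉ S, p j ≤ p i) : ∑ i ∈ T, p i ≤ ∑ i ∈ S, p i := by
  have hdiff : (T \ S).card ≤ (S \ T).card := by
    have hT := card_sdiff_add_card_inter T S
    have hS := card_sdiff_add_card_inter S T
    rw [inter_comm] at hS
    omega
  suffices h : ∑ i ∈ T \ S, p i ≤ ∑ i ∈ S \ T, p i by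
    have hT := sum_inter_add_sum_sdiff T S p
    have hS := sum_inter_add_sum_sdiff S T p
    rw [inter_comm] at hS
    linarith
  rcases (S \ T).eq_empty_or_nonempty with hempty | hne
  · have hTS : T \ S = ∅ := by
      rw [hempty, card_empty] at hdiff
      exact card_eq_zero.mp (Nat.le_zero.mp hdiff)
    rw [hTS, hempty]
  · obtain ⟨m, hm, hmin⟩ := exists_min_image (S \ T) p hne
    calc ∑ i ∈ T \ S, p i
        ≤ (T \ S).card • p m := sum_le_card_nsmul _ _ _ fun j hj =>
          hdom m (mem_sdiff.mp hm).1 j (mem_sdiff.mp hj).2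
      _ ≤ (S \ T).card • p m := nsmul_le_nsmul_left (hp m) hdiff
      _ ≤ ∑ i ∈ S \ T, p i := card_nsmul_le_sum _ _ _ hmin

/-- A tangent-line lower bound for a term of the Kullback-Leibler divergence. -/
lemma sub_div_sub_mul_log_le_mul_log_div {q p c : ℝ} (hq : 0 < q) (hp : 0 < p) (hc : 0 < c) :
    q - p / c - q * Real.log c ≤ q * Real.log (q / p) := by
  have hlog : Real.log (q / p * c) = Real.log (q / p) + Real.log c :=
    Real.log_mul (by positivity) hc.ne'
  have htan := mul_le_mul_of_nonneg_left
    (Real.one_sub_inv_le_log_of_pos (show 0 < q / p * c by positivity)) hq.le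
  have hinv : q * (1 - (q / p * c)⁻¹) = q - p / c := by field_simp
  rw [hinv, hlog] at htan
  linarith

/-- **Optimality of Top-k Routing.** The renormalized truncation of `p` to a top-`k`
set `S` is a probability vector with at most `k` nonzero entries, and it minimizes
the KL divergence to `p` among all `k`-sparse probability vectors. -/
theorem topk_optimal_sparse_kl (E k : ℕ) (hE : 1 ≤ E) (hk1 : 1 ≤ k) (hkE : k ≤ E)
    (p : Fin E → ℝ) (hp0 : ∀ i, 0 < p i) (hpsum : ∑ i, p i = 1)
    (S : Finset (Fin E)) (hScard : S.card = k)
    (hStop : ∀ i ∈ S, ∀ j ∉ S, p j ≤ p i)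
    (qstar : Fin E → ℝ)
    (hqstar : ∀ i, qstar i = if i ∈ S then p i / (∑ j ∈ S, p j) else 0) :
    ((∀ i, 0 ≤ qstar i) ∧ (∑ i, qstar i = 1) ∧
      (Finset.univ.filter (fun i => qstar i ≠ 0)).card ≤ k) ∧
    (∀ q : Fin E → ℝ, (∀ i, 0 ≤ q i) → (∑ i, q i = 1) →
      (Finset.univ.filter (fun i => q i ≠ 0)).card ≤ k →
      ∑ i, qstar i * Real.log (qstar i / p i) ≤ ∑ i, q i * Real.log (q i / p i)) := by
  have hSne : S.Nonempty := card_pos.mp (by omega)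
  have hc : 0 < ∑ j ∈ S, p j := sum_pos (fun i _ => hp0 i) hSne
  set c := ∑ j ∈ S, p j with hcdef
  have hsum : ∑ i, qstar i = 1 := by
    simp only [hqstar, sum_ite_mem, univ_inter]
    rw [← sum_div, ← hcdef, div_self hc.ne']
  refine ⟨⟨fun i => ?_, hsum, ?_⟩, fun q hq0 hqsum hqcard => ?_⟩
  · rw [hqstar]
    split_ifs
    · exact (div_pos (hp0 i) hc).le
    · exact le_rfl
  · rw [← hScard]
    refine card_le_card fun i hi => ?_
    by_contra hiS
    exact (mem_filter.mp hi).2 (by rw [hqstar, if_neg hiS])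
  · have hstar : ∑ i, qstar i * Real.log (qstar i / p i) = -Real.log c := by
      have hterm : ∀ i, qstar i * Real.log (qstar i / p i) = qstar i * -Real.log c := by
        intro i
        by_cases hi : i ∈ S
        · have hratio : p i / c / p i = c⁻¹ := by
            have := (hp0 i).ne'
            field_simp
          rw [hqstar, if_pos hi, hratio, Real.log_inv]
        · rw [hqstar, if_neg hi, zero_mul, zero_mul]
      rw [sum_congr rfl fun i _ => hterm i, ← sum_mul, hsum, one_mul]
    set T := univ.filter fun i => q i ≠ 0 with hT
    have hsupp : ∀ i ∉ T, q i = 0 := fun i hi => by simpa [hT] using hi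
    have hmass : ∑ i ∈ T, p i ≤ c :=
      sum_le_sum_of_card_le_of_dominates (fun i => (hp0 i).le) (hScard ▸ hqcard) hStop
    have hqT : ∑ i ∈ T, q i = 1 :=
      (sum_subset (subset_univ T) fun i _ hi => hsupp i hi).trans hqsum
    calc ∑ i, qstar i * Real.log (qstar i / p i)
        = -Real.log c := hstar
      _ ≤ 1 - (∑ i ∈ T, p i) / c - 1 * Real.log c := by
          have := (div_le_one hc).mpr hmass
          linarith
      _ = ∑ i ∈ T, (q i - p i / c - q i * Real.log c) := by
          rw [sum_sub_distrib, sum_sub_distrib, ← sum_div, ← sum_mul, hqT]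
      _ ≤ ∑ i ∈ T, q i * Real.log (q i / p i) := sum_le_sum fun i hi =>
          sub_div_sub_mul_log_le_mul_log_div
            ((hq0 i).lt_of_ne' (mem_filter.mp hi).2) (hp0 i) hc
      _ = ∑ i, q i * Real.log (q i / p i) :=
          sum_subset (subset_univ T) fun i _ hi => by rw [hsupp i hi, zero_mul]
end

section
/- Let H be a real inner product space, I a finite index set, and (E_i)_{i∈I} a family of unit vectors (‖E_i‖ = 1 for all i). Let μ ≥ 0 satisfy |⟪E_i, E_j⟫| ≤ μ for all i ≠ j. Let S* ⊆ I with |S*| = k ≥ 1, let α : S* → ℝ, and set y = ∑_{j∈S*} α_j · E_j. Write a = min_{j∈S*} |α_j| and b = max_{j∈S*} |α_j|. If a > (2k − 1) · μ · b, then for every i ∈ S* and every l ∈ I \ S*, |⟪E_i, y⟫| > |⟪E_l, y⟫|; in particular, when all |α_j| are equal and nonzero, the condition μ < 1/(2k − 1) suffices, so the greedy Top-k selection by |⟪E_i, y⟫| recovers exactly the optimal support S*. -/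
open Finset
open scoped RealInnerProductSpace

/-- The correlation of `E l` with a combination of family members other than `E l` is at most
the number of terms times the coherence bound times the coefficient bound. -/
theorem abs_inner_sum_smul_le_card_mul
    {H : Type*} [NormedAddCommGroup H] [InnerProductSpace ℝ H] {I : Type*}
    {E : I → H} {μ b : ℝ} (hμ : 0 ≤ μ) (hcoh : ∀ i j, i ≠ j → |⟪E i, E j⟫| ≤ μ)
    {s : Finset I} {α : I → ℝ} (hα : ∀ j ∈ s, |α j| ≤ b) {l : I} (hl : l ∉ s) :
    |⟪E l, ∑ j ∈ s, α j • E j⟫| ≤ s.card * (μ * b) := by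
  rw [inner_sum, ← nsmul_eq_mul]
  refine (Finset.abs_sum_le_sum_abs _ _).trans (Finset.sum_le_card_nsmul _ _ _ fun j hj => ?_)
  rw [real_inner_smul_right, abs_mul, mul_comm]
  exact mul_le_mul (hcoh l j (ne_of_mem_of_not_mem hj hl).symm) (hα j hj) (abs_nonneg _) hμ

/-- **The Coherence Barrier: greedy success condition.** If the coherence-weighted
gap condition `a > (2k-1)·μ·b` holds, the correlation of every in-support expert
strictly dominates every out-of-support expert, so any Top-k set for the scores
`|⟪E_i, y⟫|` is exactly the optimal support `S*`. -/
theorem coherence_barrier_greedy_success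
    {H : Type*} [NormedAddCommGroup H] [InnerProductSpace ℝ H]
    {I : Type*} [Fintype I] [DecidableEq I]
    (Ev : I → H) (hunit : ∀ i, ‖Ev i‖ = 1)
    (μ : ℝ) (hμ0 : 0 ≤ μ) (hcoh : ∀ i j, i ≠ j → |⟪Ev i, Ev j⟫| ≤ μ)
    (Sstar : Finset I) (k : ℕ) (hk : Sstar.card = k) (hk1 : 1 ≤ k)
    (hS : Sstar.Nonempty)
    (α : I → ℝ) (y : H) (hy : y = ∑ j ∈ Sstar, α j • Ev j)
    (a b : ℝ) (ha : a = Sstar.inf' hS (fun j => |α j|))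
    (hb : b = Sstar.sup' hS (fun j => |α j|))
    (hgap : (2 * (k : ℝ) - 1) * μ * b < a) :
    (∀ i ∈ Sstar, ∀ l ∉ Sstar, |⟪Ev l, y⟫| < |⟪Ev i, y⟫|) ∧
    (∀ T : Finset I, T.card = k →
      (∀ i ∈ T, ∀ l ∉ T, |⟪Ev l, y⟫| ≤ |⟪Ev i, y⟫|) → T = Sstar) := by
  have hle_b : ∀ j ∈ Sstar, |α j| ≤ b := fun j hj => hb ▸ Finset.le_sup' (fun j => |α j|) hj
  have ha_le : ∀ j ∈ Sstar, a ≤ |α j| := fun j hj => ha ▸ Finset.inf'_le (fun j => |α j|) hj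
  have hdom : ∀ i ∈ Sstar, ∀ l ∉ Sstar, |⟪Ev l, y⟫| < |⟪Ev i, y⟫| := by
    intro i hi l hl
    have hout : |⟪Ev l, y⟫| ≤ k * (μ * b) := by
      rw [hy, ← hk]
      exact abs_inner_sum_smul_le_card_mul hμ0 hcoh hle_b hl
    have hrest : |⟪Ev i, ∑ j ∈ Sstar.erase i, α j • Ev j⟫| ≤ ((k : ℝ) - 1) * (μ * b) := by
      have h := abs_inner_sum_smul_le_card_mul hμ0 hcoh
        (fun j hj => hle_b j (Finset.mem_of_mem_erase hj)) (Finset.notMem_erase i Sstar)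
      rwa [Finset.card_erase_of_mem hi, hk, Nat.cast_sub hk1, Nat.cast_one] at h
    have hsplit : ⟪Ev i, y⟫ = α i + ⟪Ev i, ∑ j ∈ Sstar.erase i, α j • Ev j⟫ := by
      rw [hy, ← Finset.add_sum_erase _ _ hi, inner_add_right, real_inner_smul_right,
        real_inner_self_eq_norm_sq, hunit, one_pow, mul_one]
    have htri : |α i| ≤ |⟪Ev i, y⟫| + |⟪Ev i, ∑ j ∈ Sstar.erase i, α j • Ev j⟫| := by
      rw [eq_sub_of_add_eq hsplit.symm]
      exact abs_sub _ _
    linarith [ha_le i hi]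
  refine ⟨hdom, fun T hT htop => ?_⟩
  refine Finset.eq_of_subset_of_card_le (fun i hiT => ?_) (by rw [hk, hT])
  by_contra hiS
  obtain ⟨l, hlS, hlT⟩ : ∃ l ∈ Sstar, l ∉ T := by
    by_contra! hsub
    exact hiS (Finset.eq_of_subset_of_card_le hsub (by rw [hk, hT]) ▸ hiT)
  exact (hdom l hlS i hiS).not_ge (htop i hiT l hlT)
end

section
/- Let H be a real inner product space, I a finite index set, and v : I → H a linearly independent family of vectors. For a finite subset T ⊆ I, let L_T be the Gram matrix with entries (L_T)_{ij} = ⟪v i, v j⟫, and define F(T) = log det(L_T). Then F is monotone submodular: for all subsets A ⊆ B ⊆ I and every e ∈ I \ B, F(A ∪ {e}) − F(A) ≥ F(B ∪ {e}) − F(B); equivalently, det(L_{A∪{e}}) · det(L_B) ≥ det(L_{B∪{e}}) · det(L_A). -/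
open Finset
open scoped RealInnerProductSpace

/-- The Gram determinant of the family `v` restricted to a finite index set `T`. -/
noncomputable def gramDet {H : Type*} [NormedAddCommGroup H] [InnerProductSpace ℝ H]
    {I : Type*} [DecidableEq I] (v : I → H) (T : Finset I) : ℝ :=
  Matrix.det (Matrix.of (fun i j : ↥T => ⟪v i, v j⟫))

instance hasOrthogonalProjection_span_range {H : Type*} [NormedAddCommGroup H]
    [InnerProductSpace ℝ H] {ι : Type*} [Finite ι] (w : ι → H) :
    (Submodule.span ℝ (Set.range w)).HasOrthogonalProjection :=
  have := FiniteDimensional.span_of_finite ℝ (Set.finite_range w)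
  inferInstance

/-- Adjoining a vector `x` to a finite family multiplies its Gram determinant by the squared
distance from `x` to the span of the family. -/
theorem det_gram_sumElim {H : Type*} [NormedAddCommGroup H] [InnerProductSpace ℝ H]
    {ι : Type*} [Fintype ι] [DecidableEq ι] (w : ι → H) (x : H) :
    (Matrix.gram ℝ (Sum.elim w fun _ : Unit => x)).det =
      ‖x - (Submodule.span ℝ (Set.range w)).starProjection x‖ ^ 2 * (Matrix.gram ℝ w).det := by
  set K := Submodule.span ℝ (Set.range w)
  obtain ⟨c, hc⟩ := (Submodule.mem_span_range_iff_exists_fun ℝ).1 (K.starProjection_apply_mem x)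
  set r := x - K.starProjection x with hr
  have hrK : ∀ y ∈ K, ⟪r, y⟫ = 0 := fun y hy => K.starProjection_inner_eq_zero x y hy
  have hrw : ∀ j, ⟪r, w j⟫ = 0 := fun j => hrK _ (Submodule.subset_span ⟨j, rfl⟩)
  have hrx : ⟪r, x⟫ = ‖r‖ ^ 2 := by
    rw [← real_inner_self_eq_norm_sq]
    nth_rewrite 3 [hr]
    rw [inner_sub_right, hrK _ (K.starProjection_apply_mem x), sub_zero]
  have hrow : ∀ y, ⟪x, y⟫ - ∑ j, c j * ⟪w j, y⟫ = ⟪r, y⟫ := fun y => by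
    rw [hr, inner_sub_left, ← hc, sum_inner]
    simp_rw [real_inner_smul_left]
  have hmul : Matrix.fromBlocks 1 0 (Matrix.of fun (_ : Unit) j => -c j) 1 *
      Matrix.gram ℝ (Sum.elim w fun _ : Unit => x) =
      Matrix.fromBlocks (Matrix.gram ℝ w) (Matrix.of fun i _ => ⟪w i, x⟫) 0
        (Matrix.of fun _ _ => ‖r‖ ^ 2) := by
    ext (i | i) (j | j)
    · simp [Matrix.mul_apply, Matrix.one_apply]
    · simp [Matrix.mul_apply, Matrix.one_apply]
    · simp [Matrix.mul_apply, ← hrw j, ← hrow, neg_add_eq_sub]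
    · simp only [Matrix.mul_apply, Matrix.fromBlocks_apply₂₂, Matrix.of_apply, ← hrx, ← hrow]
      simp [neg_add_eq_sub]
  have hdet := congrArg Matrix.det hmul
  rw [Matrix.det_mul, Matrix.det_fromBlocks_zero₁₂, Matrix.det_fromBlocks_zero₂₁] at hdet
  simpa [mul_comm] using hdet

theorem gramDet_insert {H : Type*} [NormedAddCommGroup H] [InnerProductSpace ℝ H]
    {I : Type*} [DecidableEq I] (v : I → H) {T : Finset I} {e : I} (he : e ∉ T) :
    gramDet v (insert e T) =
      ‖v e - (Submodule.span ℝ (Set.range fun i : T => v i)).starProjection (v e)‖ ^ 2 *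
        gramDet v T := by
  let f : T ⊕ Unit ≃ ↥(insert e T) :=
    (Equiv.optionEquivSumPUnit _).symm.trans (Finset.subtypeInsertEquivOption he).symm
  have hf : (fun i => v (f i)) = Sum.elim (fun i : T => v i) fun _ : Unit => v e := by
    ext (i | i) <;> simp [f, Finset.subtypeInsertEquivOption]
  refine Eq.trans ?_ (det_gram_sumElim (fun i : T => v i) (v e))
  rw [← hf]
  exact (Matrix.det_submatrix_equiv_self f _).symm

theorem gramDet_pos {H : Type*} [NormedAddCommGroup H] [InnerProductSpace ℝ H]
    {I : Type*} [DecidableEq I] {v : I → H} (hli : LinearIndependent ℝ v) (T : Finset I) :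
    0 < gramDet v T :=
  (Matrix.posDef_gram_of_linearIndependent
    (hli.comp (fun i : T => (i : I)) Subtype.val_injective)).det_pos

/-- **Monotone submodularity of the log-determinant.** For a linearly independent
family, `F(T) = log det(L_T)` satisfies the diminishing-returns inequality
`F(A∪{e}) - F(A) ≥ F(B∪{e}) - F(B)` for `A ⊆ B` and `e ∉ B`; equivalently
`det(L_{A∪{e}})·det(L_B) ≥ det(L_{B∪{e}})·det(L_A)`. -/
theorem logdet_gram_submodular
    {H : Type*} [NormedAddCommGroup H] [InnerProductSpace ℝ H]
    {I : Type*} [Fintype I] [DecidableEq I]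
    (v : I → H) (hli : LinearIndependent ℝ v)
    (A B : Finset I) (hAB : A ⊆ B) (e : I) (he : e ∉ B) :
    (Real.log (gramDet v (insert e B)) - Real.log (gramDet v B) ≤
      Real.log (gramDet v (insert e A)) - Real.log (gramDet v A)) ∧
    (gramDet v (insert e B) * gramDet v A ≤ gramDet v (insert e A) * gramDet v B) := by
  have hpos := gramDet_pos hli
  have hmul : gramDet v (insert e B) * gramDet v A ≤ gramDet v (insert e A) * gramDet v B := by
    set KA := Submodule.span ℝ (Set.range fun i : A => v i) with hKA
    set KB := Submodule.span ℝ (Set.range fun i : B => v i) with hKB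
    have hle : KA ≤ KB := Submodule.span_mono <| by
      rintro _ ⟨i, rfl⟩
      exact ⟨⟨i, hAB i.2⟩, rfl⟩
    have hdist : ‖v e - KB.starProjection (v e)‖ ≤ ‖v e - KA.starProjection (v e)‖ := by
      rw [KB.starProjection_minimal]
      exact ciInf_le ⟨0, by rintro _ ⟨_, rfl⟩; positivity⟩
        (⟨_, hle (KA.starProjection_apply_mem (v e))⟩ : KB)
    rw [gramDet_insert v he, gramDet_insert v (fun h => he (hAB h)), mul_assoc, mul_assoc,
      mul_comm (gramDet v A)]
    have := (hpos A).le
    have := (hpos B).le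
    gcongr
  refine ⟨?_, hmul⟩
  rw [sub_le_sub_iff, ← Real.log_mul (hpos _).ne' (hpos _).ne',
    ← Real.log_mul (hpos _).ne' (hpos _).ne']
  exact Real.log_le_log (mul_pos (hpos _) (hpos _)) hmul
end

section
/- Let m ≥ 1 and n ≥ 1, let S : Fin n → Finset (Fin (3m)) be a collection of subsets of Fin (3m) with |S_j| = 3 for every j, and let E be the incidence matrix in Matrix (Fin (3m)) (Fin n) ℝ with E_{ij} = 1 if i ∈ S_j and 0 otherwise. If α : Fin n → ℝ has at most m nonzero entries and satisfies E.mulVec α = 𝟙 (the all-ones vector), then the support Ω = {j : α_j ≠ 0} has cardinality exactly m, the sets {S_j : j ∈ Ω} are pairwise disjoint with union equal to Fin (3m) (i.e. Ω is an exact cover), and α_j = 1 for every j ∈ Ω. -/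
open Finset

/-- A family of sets of size at most `k` whose union has at least `k * #Ω` elements is pairwise
disjoint. -/
theorem pairwiseDisjoint_of_card_mul_le_card_biUnion {ι β : Type*} [DecidableEq ι] [DecidableEq β]
    {Ω : Finset ι} {S : ι → Finset β} {k : ℕ} (hS : ∀ j ∈ Ω, (S j).card ≤ k)
    (h : Ω.card * k ≤ (Ω.biUnion S).card) :
    ∀ j ∈ Ω, ∀ j' ∈ Ω, j ≠ j' → Disjoint (S j) (S j') := by
  intro j hj j' hj' hne
  rw [Finset.disjoint_left]
  intro x hx hx'
  have hsub : Ω.biUnion S ⊆ (Ω.erase j).biUnion S ∪ (S j).erase x := by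
    intro y hy
    obtain ⟨i, hi, hyi⟩ := Finset.mem_biUnion.1 hy
    rw [Finset.mem_union, Finset.mem_biUnion]
    by_cases hij : i = j
    · subst hij
      by_cases hyx : y = x
      · exact Or.inl ⟨j', Finset.mem_erase.2 ⟨hne.symm, hj'⟩, hyx ▸ hx'⟩
      · exact Or.inr (Finset.mem_erase.2 ⟨hyx, hyi⟩)
    · exact Or.inl ⟨i, Finset.mem_erase.2 ⟨hij, hi⟩, hyi⟩
  have hunion := (Finset.card_le_card hsub).trans (Finset.card_union_le _ _)
  have hrest : ((Ω.erase j).biUnion S).card ≤ (Ω.erase j).card * k :=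
    Finset.card_biUnion_le_card_mul _ _ _ fun i hi => hS i (Finset.mem_of_mem_erase hi)
  have hjk := hS j hj
  have hlt := Finset.card_erase_lt_of_mem hx
  have hcard := Finset.card_erase_add_one hj
  rw [← hcard, add_mul] at h
  omega

/-- **X3C reduction, converse direction.** Any `m`-sparse solution of `E · α = 𝟙`
must be the 0/1 indicator of an exact cover: its support `Ω` has cardinality exactly
`m`, the sets `{S_j : j ∈ Ω}` are pairwise disjoint and cover the universe, and
`α_j = 1` on the support. -/
theorem x3c_sparse_solution_gives_exact_cover (m n : ℕ) (hm : 1 ≤ m) (hn : 1 ≤ n)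
    (S : Fin n → Finset (Fin (3 * m))) (hS3 : ∀ j, (S j).card = 3)
    (E : Matrix (Fin (3 * m)) (Fin n) ℝ)
    (hE : ∀ i j, E i j = if i ∈ S j then 1 else 0)
    (α : Fin n → ℝ)
    (hsparse : (Finset.univ.filter (fun j => α j ≠ 0)).card ≤ m)
    (hα : E.mulVec α = fun _ => 1) :
    (Finset.univ.filter (fun j => α j ≠ 0)).card = m ∧
    (∀ j ∈ Finset.univ.filter (fun j => α j ≠ 0),
      ∀ j' ∈ Finset.univ.filter (fun j => α j ≠ 0),
        j ≠ j' → Disjoint (S j) (S j')) ∧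
    (∀ x : Fin (3 * m), ∃ j ∈ Finset.univ.filter (fun j => α j ≠ 0), x ∈ S j) ∧
    (∀ j ∈ Finset.univ.filter (fun j => α j ≠ 0), α j = 1) := by
  have hsum (x : Fin (3 * m)) : ∑ j, (if x ∈ S j then α j else 0) = 1 := by
    simpa [Matrix.mulVec, dotProduct, hE] using congrFun hα x
  set Ω := Finset.univ.filter (fun j => α j ≠ 0) with hΩ
  have hcover (x : Fin (3 * m)) : ∃ j ∈ Ω, x ∈ S j := by
    obtain ⟨j, -, hj⟩ := Finset.exists_ne_zero_of_sum_ne_zero ((hsum x).trans_ne one_ne_zero)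
    have hxj : x ∈ S j := by
      by_contra hxj
      exact hj (if_neg hxj)
    rw [if_pos hxj] at hj
    exact ⟨j, by simpa [hΩ] using hj, hxj⟩
  have hunion : (Ω.biUnion S).card = 3 * m := by
    rw [Finset.eq_univ_iff_forall.2 fun x => Finset.mem_biUnion.2 (hcover x), Finset.card_univ,
      Fintype.card_fin]
  have hle : (Ω.biUnion S).card ≤ Ω.card * 3 :=
    Finset.card_biUnion_le_card_mul _ _ _ fun j _ => (hS3 j).le
  have hdisj : ∀ j ∈ Ω, ∀ j' ∈ Ω, j ≠ j' → Disjoint (S j) (S j') :=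
    pairwiseDisjoint_of_card_mul_le_card_biUnion (fun j _ => (hS3 j).le) (by omega)
  refine ⟨by omega, hdisj, hcover, fun j hj => ?_⟩
  obtain ⟨x, hx⟩ := Finset.card_pos.1 ((hS3 j).symm ▸ three_pos)
  have hval := hsum x
  rw [Finset.sum_eq_single j _ (by simp), if_pos hx] at hval
  · exact hval
  · intro i _ hij
    by_cases hxi : x ∈ S i
    · by_contra hi
      rw [if_pos hxi] at hi
      exact Finset.disjoint_left.1 (hdisj i (by simpa [hΩ] using hi) j hj hij) hxi hx
    · exact if_neg hxi
end
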